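/- Suppose ρ and σ are quantum states on a system including a classical register Z of dimension |𝒵|, satisfying ρ = δσ + (1−δ)σ' for some state σ' and δ ∈ (0,1]. Then, writing σ_z for the state of σ conditioned on Z=z and P_Z for the distribution of Z in σ, we have E_{z∼P_Z} D(σ_z ‖ ρ) ≤ log(1/δ) + log|𝒵|. -/

import Mathlib

open Matrix
open scoped ComplexOrder

open scoped Classical in
/-- The base-2 matrix logarithm of a Hermitian matrix, via its spectral
decomposition (junk value `0` on non-Hermitian matrices). -/
noncomputable def matLog2 {n : Type*} [Fintype n] [DecidableEq n]
    (A : Matrix n n ℂ) : Matrix n n ℂ :=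
  if h : A.IsHermitian then h.cfc (fun x => Real.logb 2 x) else 0

/-- The quantum relative entropy `D(ρ‖σ) = Tr(ρ log ρ) − Tr(ρ log σ)` (in bits). -/
noncomputable def relEnt {n : Type*} [Fintype n] [DecidableEq n]
    (ρ σ : Matrix n n ℂ) : ℝ :=
  ((ρ * (matLog2 ρ - matLog2 σ)).trace).re

/-- The conditional state `σ_z = |z⟩⟨z| ⊗ σ_{Q|z}` of a CQ state `σ` on `Z × Q`. -/
noncomputable def cqCond {Z Q : Type*} [Fintype Q] [DecidableEq Z]
    (σ : Matrix (Z × Q) (Z × Q) ℂ) (z : Z) : Matrix (Z × Q) (Z × Q) ℂ :=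
  Matrix.of fun p q =>
    if p.1 = z ∧ q.1 = z
    then ((((∑ q', σ (z, q') (z, q')).re)⁻¹ : ℝ) : ℂ) * σ p q
    else 0

theorem jpy_trace_formula {n : Type*} [Fintype n] [DecidableEq n]
    (U V : Matrix n n ℂ) (a b : n → ℝ) :
    ((U * diagonal (fun i => (a i : ℂ)) * star U * (V * diagonal (fun i => (b i : ℂ)) * star V)).trace).re
      = ∑ i, ∑ j, a i * b j * Complex.normSq ((star U * V) i j) := by
  have h : (U * diagonal (fun i => (a i : ℂ)) * star U * (V * diagonal (fun i => (b i : ℂ)) * star V)).trace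
      = (diagonal (fun i => (a i : ℂ)) * (star U * V) * diagonal (fun i => (b i : ℂ)) * star (star U * V)).trace := by
    rw [show U * diagonal (fun i => (a i : ℂ)) * star U * (V * diagonal (fun i => (b i : ℂ)) * star V)
      = U * (diagonal (fun i => (a i : ℂ)) * star U * (V * diagonal (fun i => (b i : ℂ)) * star V)) by
        simp only [Matrix.mul_assoc], Matrix.trace_mul_comm]
    simp only [star_mul, star_star, Matrix.mul_assoc]
  rw [h]
  generalize star U * V = W
  simp only [Matrix.trace, Matrix.diag, Complex.re_sum]
  refine Finset.sum_congr rfl fun i _ => ?_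
  rw [Matrix.mul_apply, Complex.re_sum]
  refine Finset.sum_congr rfl fun j _ => ?_
  rw [Matrix.mul_diagonal, Matrix.diagonal_mul, Matrix.star_apply]
  rw [show (a i : ℂ) * W i j * (b j : ℂ) * star (W i j) = ((a i * b j : ℝ) : ℂ) * (W i j * star (W i j)) by
    push_cast; ring]
  rw [show W i j * star (W i j) = ((Complex.normSq (W i j) : ℝ) : ℂ) from Complex.mul_conj _]
  rw [← Complex.ofReal_mul, Complex.ofReal_re]

theorem jpy_row {n : Type*} [Fintype n] [DecidableEq n]
    (W : Matrix n n ℂ) (hW : W * star W = 1) (i : n) : ∑ j, Complex.normSq (W i j) = 1 := by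
  have h := congrFun (congrFun hW i) i
  rw [Matrix.mul_apply, Matrix.one_apply_eq] at h
  have h2 := congrArg Complex.re h
  rw [Complex.re_sum] at h2
  rw [← Complex.one_re, ← h2]
  refine Finset.sum_congr rfl fun j _ => ?_
  rw [Matrix.star_apply, show W i j * star (W i j) = ((Complex.normSq (W i j) : ℝ) : ℂ) from Complex.mul_conj _,
    Complex.ofReal_re]

theorem jpy_quad {n : Type*} [Fintype n] [DecidableEq n]
    (W : Matrix n n ℂ) (a r : n → ℝ) (ha : ∀ i, 0 ≤ a i) (c : ℝ)
    (hM : ((c : ℂ) • diagonal (fun i => (r i : ℂ)) - star W * diagonal (fun i => (a i : ℂ)) * W).PosSemidef)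
    (x : n → ℂ) (i : n) :
    a i * Complex.normSq ((W *ᵥ x) i) ≤ c * ∑ j, r j * Complex.normSq (x j) := by
  have h := hM.dotProduct_mulVec_nonneg x
  have key : ∀ (d : n → ℝ) (y : n → ℂ), star y ⬝ᵥ (diagonal (fun i => (d i : ℂ)) *ᵥ y)
      = ((∑ j, d j * Complex.normSq (y j) : ℝ) : ℂ) := by
    intro d y
    simp only [dotProduct, Complex.ofReal_sum, Matrix.mulVec_diagonal, Pi.star_apply]
    refine Finset.sum_congr rfl fun j _ => ?_
    rw [Complex.ofReal_mul, ← Complex.mul_conj]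
    change (starRingEnd ℂ) (y j) * _ = _
    ring
  have e2 : star x ⬝ᵥ ((star W * diagonal (fun i => (a i : ℂ)) * W) *ᵥ x)
      = ((∑ j, a j * Complex.normSq ((W *ᵥ x) j) : ℝ) : ℂ) := by
    rw [← key, Matrix.star_mulVec, ← Matrix.mulVec_mulVec, ← Matrix.mulVec_mulVec,
      Matrix.dotProduct_mulVec (star x)]
    rfl
  rw [Matrix.sub_mulVec, Matrix.smul_mulVec, dotProduct_sub, dotProduct_smul, key, e2, smul_eq_mul,
    ← Complex.ofReal_mul, ← Complex.ofReal_sub, Complex.zero_le_real] at h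
  have := Finset.single_le_sum (f := fun j => a j * Complex.normSq ((W *ᵥ x) j))
    (fun j _ => mul_nonneg (ha j) (Complex.normSq_nonneg _)) (Finset.mem_univ i)
  linarith

theorem jpy_core {n : Type*} [Fintype n] [DecidableEq n]
    (W : Matrix n n ℂ) (hW : W * star W = 1) (a r : n → ℝ) (ha : ∀ i, 0 ≤ a i) (hr : ∀ i, 0 ≤ r i)
    (c : ℝ) (hc : 0 < c)
    (hM : ((c : ℂ) • diagonal (fun i => (r i : ℂ)) - star W * diagonal (fun i => (a i : ℂ)) * W).PosSemidef)
    (i : n) :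
    ∑ j, a i * Complex.normSq (W i j) * (Real.log (a i) - Real.log (r j)) ≤ a i * Real.log c := by
  have hq := jpy_quad W a r ha c hM
  rcases (ha i).eq_or_lt with h0 | hpos
  · simp [← h0]
  have hrow := jpy_row W hW i
  set w : n → ℝ := fun j => Complex.normSq (W i j) with hw
  have hw0 : ∀ j, 0 ≤ w j := fun j => Complex.normSq_nonneg _
  have hsupp : ∀ j, r j = 0 → w j = 0 := by
    intro j hj
    have h := hq (Pi.single j 1) i
    rw [Matrix.mulVec_single_one] at h
    have hz : ∑ k, r k * Complex.normSq ((Pi.single j 1 : n → ℂ) k) = 0 := by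
      refine Finset.sum_eq_zero fun k _ => ?_
      by_cases hk : k = j
      · subst hk; simp [hj]
      · simp [Pi.single_eq_of_ne hk]
    rw [hz, mul_zero] at h
    have : a i * w j ≤ 0 := h
    have h3 := hw0 j
    nlinarith
  have ht : a i * ∑ j, w j * (r j)⁻¹ ≤ c := by
    set t := ∑ j, w j * (r j)⁻¹ with htdef
    have ht0 : 0 ≤ t := Finset.sum_nonneg fun j _ => mul_nonneg (hw0 j) (inv_nonneg.2 (hr j))
    have h := hq (fun j => (((r j)⁻¹ : ℝ) : ℂ) * (starRingEnd ℂ) (W i j)) i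
    have e1 : (W *ᵥ (fun j => (((r j)⁻¹ : ℝ) : ℂ) * (starRingEnd ℂ) (W i j))) i = (t : ℂ) := by
      rw [htdef, Complex.ofReal_sum]
      simp only [Matrix.mulVec, dotProduct]
      refine Finset.sum_congr rfl fun j _ => ?_
      rw [Complex.ofReal_mul, hw]
      simp only
      rw [← Complex.mul_conj]; ring
    have e2 : ∑ j, r j * Complex.normSq ((((r j)⁻¹ : ℝ) : ℂ) * (starRingEnd ℂ) (W i j)) = t := by
      rw [htdef]
      refine Finset.sum_congr rfl fun j _ => ?_
      rw [Complex.normSq_mul, Complex.normSq_conj, Complex.normSq_ofReal]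
      by_cases hj : r j = 0
      · simp [hj]
      · simp only [hw]; field_simp
    rw [e1, e2, Complex.normSq_ofReal] at h
    rcases ht0.eq_or_lt with h1 | h1
    · rw [← h1, mul_zero]; exact hc.le
    · exact le_of_mul_le_mul_right (by linarith) h1
  have hterm : ∀ j, w j * (Real.log (a i) - Real.log (r j)) ≤
      w j * Real.log c + (a i * (w j * (r j)⁻¹) / c - w j) := by
    intro j
    by_cases hj : r j = 0
    · rw [hsupp j hj]; simp
    have hrj : 0 < r j := lt_of_le_of_ne (hr j) (Ne.symm hj)
    have hl := Real.log_le_sub_one_of_pos (x := a i / (r j * c)) (by positivity)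
    rw [Real.log_div hpos.ne' (by positivity), Real.log_mul hj hc.ne'] at hl
    have := mul_le_mul_of_nonneg_left hl (hw0 j)
    have e : w j * (a i / (r j * c) - 1) = a i * (w j * (r j)⁻¹) / c - w j := by
      field_simp
    rw [e] at this
    linarith
  have hs := Finset.sum_le_sum (fun j (_ : j ∈ Finset.univ) => hterm j)
  rw [Finset.sum_add_distrib, Finset.sum_sub_distrib, ← Finset.sum_mul, ← Finset.sum_div,
    ← Finset.mul_sum, hrow, one_mul] at hs
  have h1 : (a i * ∑ j, w j * (r j)⁻¹) / c ≤ 1 := (div_le_one hc).2 ht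
  have : ∑ j, a i * w j * (Real.log (a i) - Real.log (r j))
      = a i * ∑ j, w j * (Real.log (a i) - Real.log (r j)) := by
    rw [Finset.mul_sum]; exact Finset.sum_congr rfl fun j _ => by ring
  rw [this]
  exact mul_le_mul_of_nonneg_left (by linarith) hpos.le

theorem jpy_relEnt_le {n : Type*} [Fintype n] [DecidableEq n]
    (A ρ : Matrix n n ℂ) (hA : A.PosSemidef) (hA1 : A.trace = 1) (hρ : ρ.PosSemidef)
    (c : ℝ) (hc : 0 < c) (hle : ((c : ℂ) • ρ - A).PosSemidef) :
    relEnt A ρ ≤ Real.logb 2 c := by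
  have hAh := hA.isHermitian
  have hρh := hρ.isHermitian
  set a := hAh.eigenvalues with ha_def
  set r := hρh.eigenvalues with hr_def
  have ha : ∀ i, 0 ≤ a i := hA.eigenvalues_nonneg
  have hr : ∀ i, 0 ≤ r i := hρ.eigenvalues_nonneg
  set U : Matrix n n ℂ := hAh.eigenvectorUnitary.1 with hU
  set V : Matrix n n ℂ := hρh.eigenvectorUnitary.1 with hV
  have hUU : star U * U = 1 := Unitary.coe_star_mul_self _
  have hVV : star V * V = 1 := Unitary.coe_star_mul_self _
  have hVV' : V * star V = 1 := Unitary.coe_mul_star_self _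
  have eA : A = U * diagonal (fun i => (a i : ℂ)) * star U := hAh.spectral_theorem
  have eρ : ρ = V * diagonal (fun i => (r i : ℂ)) * star V := hρh.spectral_theorem
  have lA : matLog2 A = U * diagonal (fun i => ((Real.logb 2 (a i) : ℝ) : ℂ)) * star U := by
    rw [matLog2, dif_pos hAh]; rfl
  have lρ : matLog2 ρ = V * diagonal (fun i => ((Real.logb 2 (r i) : ℝ) : ℂ)) * star V := by
    rw [matLog2, dif_pos hρh]; rfl
  have hW : (star U * V) * star (star U * V) = 1 := by
    rw [star_mul, star_star, Matrix.mul_assoc, ← Matrix.mul_assoc V, hVV', Matrix.one_mul, hUU]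
  have hM : ((c : ℂ) • diagonal (fun i => (r i : ℂ))
      - star (star U * V) * diagonal (fun i => (a i : ℂ)) * (star U * V)).PosSemidef := by
    have h := hle.conjTranspose_mul_mul_same V
    convert h using 1
    rw [← Matrix.star_eq_conjTranspose, Matrix.mul_sub, Matrix.sub_mul]
    congr 1
    · conv_rhs => rw [eρ]
      rw [Matrix.mul_smul, Matrix.smul_mul]
      congr 1
      rw [show star V * (V * diagonal (fun i => (r i : ℂ)) * star V) * V
        = (star V * V) * diagonal (fun i => (r i : ℂ)) * (star V * V) by simp only [Matrix.mul_assoc], hVV]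
      simp
    · conv_rhs => rw [eA]
      simp only [star_mul, star_star, Matrix.mul_assoc]
  have hsum : ∑ i, a i = 1 := by
    have h := hAh.trace_eq_sum_eigenvalues
    rw [hA1] at h
    have h2 := congrArg Complex.re h
    rw [Complex.re_sum] at h2
    exact h2.symm
  have hD : relEnt A ρ = (∑ i, ∑ j, a i * Complex.normSq ((star U * V) i j)
      * (Real.log (a i) - Real.log (r j))) / Real.log 2 := by
    rw [relEnt, Matrix.mul_sub, Matrix.trace_sub, Complex.sub_re, lA, lρ]
    conv_lhs => rw [eA]
    rw [jpy_trace_formula, jpy_trace_formula, hUU]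
    rw [← Finset.sum_sub_distrib, Finset.sum_div]
    refine Finset.sum_congr rfl fun i _ => ?_
    have e : ∑ j, a i * Real.logb 2 (a j) * Complex.normSq ((1 : Matrix n n ℂ) i j)
        = ∑ j, a i * Real.logb 2 (a i) * Complex.normSq ((star U * V) i j) := by
      rw [← Finset.mul_sum, jpy_row _ hW, Finset.sum_eq_single i]
      · simp
      · intro j _ hj; simp [Matrix.one_apply_ne hj.symm]
      · simp
    rw [e, ← Finset.sum_sub_distrib, Finset.sum_div]
    refine Finset.sum_congr rfl fun j _ => ?_
    simp only [Real.logb]; ring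
  rw [hD, Real.logb]
  refine div_le_div_of_nonneg_right ?_ (Real.log_nonneg (by norm_num))
  calc _ ≤ ∑ i, a i * Real.log c :=
        Finset.sum_le_sum fun i _ => jpy_core _ hW a r ha hr c hc hM i
    _ = Real.log c := by rw [← Finset.sum_mul, hsum, one_mul]

theorem jpy_cond_le {Z Q : Type*} [Fintype Z] [Fintype Q]
    [DecidableEq Z] [DecidableEq Q]
    (ρ σ σ' : Matrix (Z × Q) (Z × Q) ℂ) (hρ : ρ.PosSemidef)
    (hσ : σ.PosSemidef) (hσ' : σ'.PosSemidef)
    (δ : ℝ) (hδ0 : 0 < δ) (hδ1 : δ ≤ 1)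
    (hmix : ρ = ((δ : ℝ) : ℂ) • σ + (((1 - δ : ℝ)) : ℂ) • σ')
    (hCQ : ∀ p q : Z × Q, p.1 ≠ q.1 → σ p q = 0) (z : Z)
    (hp : 0 < (∑ q, σ (z, q) (z, q)).re) :
    relEnt (cqCond σ z) ρ ≤ Real.logb 2 (1 / ((∑ q, σ (z, q) (z, q)).re * δ)) := by
  set p := (∑ q, σ (z, q) (z, q)).re with hpdef
  have hpC : ∑ q, σ (z, q) (z, q) = (p : ℂ) := by
    have : 0 ≤ ∑ q, σ (z, q) (z, q) := Finset.sum_nonneg fun q _ => hσ.diag_nonneg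
    exact Complex.eq_re_of_ofReal_le (r := 0) (by simpa using this)
  set P : Matrix (Z × Q) (Z × Q) ℂ := diagonal (fun x => if x.1 = z then 1 else 0) with hP
  set P' : Matrix (Z × Q) (Z × Q) ℂ := diagonal (fun x => if x.1 = z then 0 else 1) with hP'
  have hPh : Pᴴ = P := by
    rw [hP, Matrix.diagonal_conjTranspose]; congr 1; ext x; simp [apply_ite]
  have hPh' : P'ᴴ = P' := by
    rw [hP', Matrix.diagonal_conjTranspose]; congr 1; ext x; simp [apply_ite]
  have hB : (P * σ * P).PosSemidef := by
    have := hσ.conjTranspose_mul_mul_same P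
    rwa [hPh] at this
  have hB' : (P' * σ * P').PosSemidef := by
    have := hσ.conjTranspose_mul_mul_same P'
    rwa [hPh'] at this
  have hcq : cqCond σ z = ((p⁻¹ : ℝ) : ℂ) • (P * σ * P) := by
    ext x y
    rw [Matrix.smul_apply, hP, Matrix.mul_diagonal, Matrix.diagonal_mul]
    simp only [cqCond, Matrix.of_apply, ← hpdef, smul_eq_mul]
    by_cases hx : x.1 = z <;> by_cases hy : y.1 = z <;> simp [hx, hy]
  have hsplit : σ = P * σ * P + P' * σ * P' := by
    ext x y
    rw [Matrix.add_apply, hP, hP', Matrix.mul_diagonal, Matrix.diagonal_mul, Matrix.mul_diagonal,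
      Matrix.diagonal_mul]
    by_cases hx : x.1 = z <;> by_cases hy : y.1 = z <;> simp [hx, hy]
    · exact hCQ _ _ (by rw [hx]; exact Ne.symm hy)
    · exact hCQ _ _ (by rw [hy]; exact hx)
  have hpi : (0 : ℂ) ≤ ((p⁻¹ : ℝ) : ℂ) := Complex.zero_le_real.2 (by positivity)
  refine jpy_relEnt_le _ _ ?_ ?_ hρ _ (by positivity) ?_
  · rw [hcq]; exact hB.smul hpi
  · have : (cqCond σ z).trace = ((p⁻¹ : ℝ) : ℂ) * ∑ q, σ (z, q) (z, q) := by
      rw [Matrix.trace, Fintype.sum_prod_type, Finset.sum_eq_single z]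
      · rw [Finset.mul_sum]
        refine Finset.sum_congr rfl fun q _ => ?_
        simp [cqCond, ← hpdef]
      · intro y _ hy
        simp [cqCond, hy]
      · simp
    rw [this, hpC, ← Complex.ofReal_mul, inv_mul_cancel₀ hp.ne', Complex.ofReal_one]
  · have e : (((1 / (p * δ) : ℝ)) : ℂ) • ρ - cqCond σ z
        = (((1 / (p * δ) * (1 - δ) : ℝ)) : ℂ) • σ' + ((p⁻¹ : ℝ) : ℂ) • (P' * σ * P') := by
      have h1 : P' * σ * P' = σ - P * σ * P := by rw [eq_sub_iff_add_eq']; exact hsplit.symm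
      rw [h1, hcq, hmix, smul_add, smul_smul, smul_smul, ← Complex.ofReal_mul, ← Complex.ofReal_mul,
        show 1 / (p * δ) * δ = p⁻¹ by field_simp, smul_sub]
      abel
    rw [e]
    refine (hσ'.smul (Complex.zero_le_real.2 ?_)).add (hB'.smul hpi)
    have : 0 ≤ 1 - δ := by linarith
    positivity

/-- Jain–Pereszlényi–Yao, Lemma III.1: if `ρ = δσ + (1−δ)σ'` with
`σ` a CQ state on the classical register `Z`, then
`E_{z∼P_Z} D(σ_z ‖ ρ) ≤ log(1/δ) + log|𝒵|`. -/
theorem jpy_conditioning {Z Q : Type*} [Fintype Z] [Fintype Q]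
    [DecidableEq Z] [DecidableEq Q]
    (ρ σ σ' : Matrix (Z × Q) (Z × Q) ℂ)
    (hρ : ρ.PosSemidef) (hρ1 : ρ.trace = 1)
    (hσ : σ.PosSemidef) (hσ1 : σ.trace = 1)
    (hσ' : σ'.PosSemidef) (hσ'1 : σ'.trace = 1)
    (δ : ℝ) (hδ0 : 0 < δ) (hδ1 : δ ≤ 1)
    (hmix : ρ = ((δ : ℝ) : ℂ) • σ + (((1 - δ : ℝ)) : ℂ) • σ')
    (hCQ : ∀ p q : Z × Q, p.1 ≠ q.1 → σ p q = 0) :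
    ∑ z, (∑ q, σ (z, q) (z, q)).re * relEnt (cqCond σ z) ρ
      ≤ Real.logb 2 (1 / δ) + Real.logb 2 (Fintype.card Z) := by
  set p : Z → ℝ := fun z => (∑ q, σ (z, q) (z, q)).re with hp
  have hp0 : ∀ z, 0 ≤ p z := fun z => by
    have : 0 ≤ ∑ q, σ (z, q) (z, q) := Finset.sum_nonneg fun q _ => hσ.diag_nonneg
    exact (Complex.le_def.1 this).1
  have hps : ∑ z, p z = 1 := by
    have h := congrArg Complex.re hσ1
    rw [Matrix.trace, Fintype.sum_prod_type, Complex.re_sum] at h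
    exact h
  have hne : Nonempty Z := by
    by_contra hcon
    rw [not_nonempty_iff] at hcon
    simp at hps
  have hN : (0 : ℝ) < Fintype.card Z := by exact_mod_cast Fintype.card_pos
  have hl2 : 0 < Real.log 2 := Real.log_pos (by norm_num)
  have hterm : ∀ z, p z * relEnt (cqCond σ z) ρ ≤
      p z * (Real.logb 2 (1 / δ) + Real.logb 2 (Fintype.card Z))
        + ((Fintype.card Z : ℝ)⁻¹ - p z) / Real.log 2 := by
    intro z
    rcases (hp0 z).eq_or_lt with h0 | hpos
    · rw [← h0]
      have : 0 ≤ ((Fintype.card Z : ℝ)⁻¹ - 0) / Real.log 2 := by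
        rw [sub_zero]; positivity
      linarith
    have h1 := jpy_cond_le ρ σ σ' hρ hσ hσ' δ hδ0 hδ1 hmix hCQ z hpos
    change _ ≤ Real.logb 2 (1 / (p z * δ)) at h1
    have h2 := Real.log_le_sub_one_of_pos (x := 1 / (p z * Fintype.card Z)) (by positivity)
    rw [one_div, Real.log_inv, Real.log_mul hpos.ne' hN.ne'] at h2
    refine (mul_le_mul_of_nonneg_left h1 hpos.le).trans ?_
    simp only [Real.logb, one_div, Real.log_inv]
    rw [Real.log_mul hpos.ne' hδ0.ne']
    have h3 := mul_le_mul_of_nonneg_left h2 hpos.le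
    rw [show p z * ((p z * (Fintype.card Z : ℝ))⁻¹ - 1) = (Fintype.card Z : ℝ)⁻¹ - p z by
      field_simp] at h3
    rw [← add_div, ← mul_div_assoc, ← mul_div_assoc, ← add_div]
    refine div_le_div_of_nonneg_right ?_ hl2.le
    linarith
  refine (Finset.sum_le_sum fun z _ => hterm z).trans ?_
  rw [Finset.sum_add_distrib, ← Finset.sum_mul, hps, one_mul, ← Finset.sum_div,
    Finset.sum_sub_distrib, hps]
  simp
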